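/- Let X be a Gaussian random variable with mean μ and variance σ² > 0, and let GELU(x) = x·Φ(x), whose derivative is GELU'(x) = Φ(x) + x·φ(x). Then E[GELU'(X)] = Φ(μ/√(1 + σ²)) + φ(μ/√(1 + σ²)) · [ μ/√(1 + σ²) − μσ²/(1 + σ²)^{3/2} ]. -/

import Mathlib

open MeasureTheory ProbabilityTheory Real

/-- The standard normal density `φ(z) = exp(-z²/2)/√(2π)`. -/
noncomputable def stdNormalPDF (z : ℝ) : ℝ := Real.exp (-(z ^ 2) / 2) / Real.sqrt (2 * Real.pi)

/-- The standard normal CDF `Φ(x) = ∫_{-∞}^x φ(z) dz`. -/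
noncomputable def stdNormalCDF (x : ℝ) : ℝ := ∫ z in Set.Iic x, stdNormalPDF z

open scoped NNReal

lemma stdNormalPDF_eq_gaussianPDFReal (z : ℝ) : stdNormalPDF z = gaussianPDFReal 0 1 z := by
  simp [stdNormalPDF, gaussianPDFReal, div_eq_inv_mul]

lemma stdNormalCDF_eq_gaussianReal_real (x : ℝ) :
    stdNormalCDF x = (gaussianReal 0 1).real (Set.Iic x) := by
  have h0 : 0 ≤ ∫ z in Set.Iic x, gaussianPDFReal 0 1 z :=
    integral_nonneg fun z => gaussianPDFReal_nonneg 0 1 z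
  simp only [stdNormalCDF, stdNormalPDF_eq_gaussianPDFReal, Measure.real]
  rw [gaussianReal_apply_eq_integral _ one_ne_zero, ENNReal.toReal_ofReal h0]

lemma measurable_stdNormalCDF : Measurable stdNormalCDF := by
  refine Monotone.measurable fun x y hxy => ?_
  simp only [stdNormalCDF_eq_gaussianReal_real]
  exact measureReal_mono (Set.Iic_subset_Iic.2 hxy)

lemma integrable_stdNormalCDF (P : Measure ℝ) [IsFiniteMeasure P] : Integrable stdNormalCDF P := by
  refine Integrable.of_bound measurable_stdNormalCDF.aestronglyMeasurable 1 (.of_forall fun x => ?_)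
  rw [stdNormalCDF_eq_gaussianReal_real, Real.norm_of_nonneg measureReal_nonneg]
  exact measureReal_le_one

/-- A Gaussian left tail expressed with the standard normal CDF. -/
lemma gaussianReal_real_Iic (m : ℝ) {c : ℝ} (hc : 0 < c) (v : ℝ≥0) (hv : (v : ℝ) = c ^ 2) (x : ℝ) :
    (gaussianReal m v).real (Set.Iic x) = stdNormalCDF ((x - m) / c) := by
  have hmap : (gaussianReal 0 1).map (fun z => c * z + m) = gaussianReal m v := by
    have h : (fun z : ℝ => c * z + m) = (fun z => z + m) ∘ (fun z => c * z) := rfl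
    rw [h, ← Measure.map_map (by fun_prop) (by fun_prop), gaussianReal_map_const_mul,
      gaussianReal_map_add_const]
    congr 1
    · simp
    · ext
      simp [hv]
  rw [← hmap, map_measureReal_apply (by fun_prop) measurableSet_Iic,
    stdNormalCDF_eq_gaussianReal_real]
  congr 1
  ext z
  simp only [Set.mem_preimage, Set.mem_Iic]
  rw [le_div_iff₀ hc]
  constructor <;> intro h <;> linarith

/-- The Gaussian mean of the standard normal CDF. -/
lemma integral_stdNormalCDF_gaussianReal (μ : ℝ) (v : ℝ≥0) :
    ∫ x, stdNormalCDF x ∂(gaussianReal μ v) = stdNormalCDF (μ / √(1 + v)) := by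
  have hconv := gaussianReal_conv_gaussianReal (m₁ := -μ) (m₂ := 0) (v₁ := v) (v₂ := 1)
  have htail := gaussianReal_real_Iic (-μ + 0) (c := √(1 + v)) (by positivity) (v + 1)
    (by rw [Real.sq_sqrt (by positivity)]; push_cast; ring) 0
  have hset : MeasurableSet ((fun p : ℝ × ℝ => p.1 + p.2) ⁻¹' Set.Iic 0) :=
    (measurable_fst.add measurable_snd) measurableSet_Iic
  rw [← hconv, Measure.conv, map_measureReal_apply (by fun_prop) measurableSet_Iic,
    Measure.real, Measure.prod_apply hset, ← integral_toReal
      (measurable_measure_prodMk_left hset).aemeasurable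
      (.of_forall fun x => measure_lt_top _ _)] at htail
  have hset' (x : ℝ) : Prod.mk x ⁻¹' ((fun p : ℝ × ℝ => p.1 + p.2) ⁻¹' Set.Iic 0)
      = Set.Iic (-x) := by
    ext z
    simp only [Set.mem_preimage, Set.mem_Iic]
    constructor <;> intro h <;> linarith
  simp only [hset', ← gaussianReal_map_neg] at htail
  rw [integral_map (by fun_prop) ?_] at htail
  · simpa [stdNormalCDF_eq_gaussianReal_real, Measure.real] using htail
  · have := (measurable_stdNormalCDF.comp measurable_neg).aestronglyMeasurable
      (μ := (gaussianReal μ v).map fun x => -x)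
    simpa [Function.comp_def, stdNormalCDF_eq_gaussianReal_real, Measure.real] using this

/-- The product of two Gaussian densities is a multiple of a Gaussian density. -/
lemma gaussianPDFReal_mul_stdNormalPDF (μ : ℝ) {v : ℝ≥0} (hv : v ≠ 0) (x : ℝ) :
    gaussianPDFReal μ v x * stdNormalPDF x =
      stdNormalPDF (μ / √(1 + v)) / √(1 + v) *
        gaussianPDFReal (μ / (1 + v)) (v / (1 + v)) x := by
  have hv' : (0 : ℝ) < v := by exact_mod_cast pos_iff_ne_zero.2 hv
  have h1 : (0 : ℝ) < 1 + v := by positivity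
  have hexp : -(x - μ) ^ 2 / (2 * v) + -x ^ 2 / 2 =
      -(μ / √(1 + v)) ^ 2 / 2 + -(x - μ / (1 + v)) ^ 2 / (2 * (v / (1 + v))) := by
    rw [div_pow, Real.sq_sqrt h1.le]
    field_simp
    ring
  have hsqrt : √(2 * π * (v / (1 + v))) = √(2 * π * v) / √(1 + v) := by
    rw [← Real.sqrt_div (by positivity)]
    congr 1
    ring
  have hmul := congrArg Real.exp hexp
  rw [Real.exp_add, Real.exp_add] at hmul
  simp only [gaussianPDFReal, stdNormalPDF]
  push_cast
  rw [hsqrt]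
  have hc : 0 < √(1 + (v : ℝ)) := by positivity
  calc _ = (√(2 * π * v))⁻¹ * (√(2 * π))⁻¹ *
        (rexp (-(x - μ) ^ 2 / (2 * v)) * rexp (-x ^ 2 / 2)) := by ring
    _ = _ := by
      rw [hmul]
      field_simp

lemma integral_mul_stdNormalPDF_gaussianReal (μ : ℝ) {v : ℝ≥0} (hv : v ≠ 0) :
    ∫ x, x * stdNormalPDF x ∂(gaussianReal μ v) =
      stdNormalPDF (μ / √(1 + v)) / √(1 + v) * (μ / (1 + v)) := by
  have hw : v / (1 + v) ≠ 0 := by positivity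
  have hmean := integral_id_gaussianReal (μ := μ / (1 + v)) (v := v / (1 + v))
  rw [integral_gaussianReal_eq_integral_smul hw] at hmean
  rw [integral_gaussianReal_eq_integral_smul hv, ← hmean, ← integral_const_mul]
  congr 1 with x
  simp only [smul_eq_mul]
  linear_combination x * gaussianPDFReal_mul_stdNormalPDF μ hv x

lemma integrable_mul_stdNormalPDF_gaussianReal (μ : ℝ) (v : ℝ≥0) :
    Integrable (fun x => x * stdNormalPDF x) (gaussianReal μ v) := by
  have hid : Integrable (fun x : ℝ => x) (gaussianReal μ v) :=
    (memLp_id_gaussianReal 1).integrable le_rfl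
  refine hid.mul_bdd (c := (√(2 * π))⁻¹) ?_ (.of_forall fun x => ?_)
  · unfold stdNormalPDF
    fun_prop
  · rw [stdNormalPDF, Real.norm_of_nonneg (by positivity), div_eq_mul_inv]
    refine mul_le_of_le_one_left (by positivity) (Real.exp_le_one_iff.2 ?_)
    linarith [sq_nonneg x]

/-- The Gaussian mean of `Φ(x) + x φ(x)`, in terms of the variance `v`. -/
lemma integral_stdNormalCDF_add_mul_stdNormalPDF (μ : ℝ) (v : ℝ≥0) (hv : v ≠ 0) :
    ∫ x, (stdNormalCDF x + x * stdNormalPDF x) ∂(gaussianReal μ v) =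
      stdNormalCDF (μ / √(1 + v)) +
        stdNormalPDF (μ / √(1 + v)) *
          (μ / √(1 + v) - μ * v / (1 + (v : ℝ)) ^ ((3 : ℝ) / 2)) := by
  have h1 : (0 : ℝ) < 1 + v := by positivity
  have hpow : (1 + (v : ℝ)) ^ ((3 : ℝ) / 2) = √(1 + v) * (1 + v) := by
    rw [show (3 : ℝ) / 2 = 1 / 2 + 1 by norm_num, Real.rpow_add h1, Real.rpow_one,
      ← Real.sqrt_eq_rpow]
  rw [integral_add (integrable_stdNormalCDF _) (integrable_mul_stdNormalPDF_gaussianReal _ _),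
    integral_stdNormalCDF_gaussianReal, integral_mul_stdNormalPDF_gaussianReal μ hv, hpow]
  have hc : 0 < √(1 + (v : ℝ)) := by positivity
  field_simp
  ring

/-- If `X ~ N(μ, σ²)` with `σ² > 0` and `GELU'(x) = Φ(x) + x φ(x)` (the derivative of
`GELU(x) = x Φ(x)`), then
`E[GELU'(X)] = Φ(μ/√(1+σ²)) + φ(μ/√(1+σ²)) (μ/√(1+σ²) - μσ²/(1+σ²)^(3/2))`. -/
theorem gelu_deriv_gaussian_mean (μ σ : ℝ) (hσ : 0 < σ) (GELU' : ℝ → ℝ)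
    (hGELU' : GELU' = fun x => stdNormalCDF x + x * stdNormalPDF x) :
    ∫ x, GELU' x ∂(gaussianReal μ ⟨σ ^ 2, sq_nonneg σ⟩) =
      stdNormalCDF (μ / Real.sqrt (1 + σ ^ 2)) +
        stdNormalPDF (μ / Real.sqrt (1 + σ ^ 2)) *
          (μ / Real.sqrt (1 + σ ^ 2) - μ * σ ^ 2 / (1 + σ ^ 2) ^ ((3 : ℝ) / 2)) := by
  subst hGELU'
  exact integral_stdNormalCDF_add_mul_stdNormalPDF μ (NNReal.mk (σ ^ 2) (sq_nonneg σ))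
    fun h => (pow_pos hσ 2).ne' (congrArg NNReal.toReal h)
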